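/- (Bilinear analogue of Proposition 3.1.) For all λ, μ, ν ∈ ℝ with δ = ν−λ−μ, every index 1 ≤ i ≤ n, every polynomial symbol P in the 3n variables (x^1,…,x^n, ξ_1,…,ξ_n, η_1,…,η_n), and all smooth f, g : ℝⁿ → ℝ, one has L_{X̄_i}^{ν}(Op(P)(f,g)) − Op(P)(L_{X̄_i}^{λ} f, g) − Op(P)(f, L_{X̄_i}^{μ} g) = Op(M̃_i P)(f,g), where M̃_i = L̂_i^δ − ξ_i·T_ξ − η_i·T_η + 2((E_ξ + nλ)·ε_i ∂_{ξ_i} + (E_η + nμ)·ε_i ∂_{η_i}), with L̂_i^δ = (Σ_j ε_j (x^j)²)∂_{x^i} − 2 x_i Σ_j x^j ∂_{x^j} − 2nδ·x_i − 2 Σ_j ((ξ_i x_j − ξ_j x_i)∂_{ξ_j} + (η_i x_j − η_j x_i)∂_{η_j}) + 2((Σ_j ξ_j x^j)·ε_i ∂_{ξ_i} + (Σ_j η_j x^j)·ε_i ∂_{η_i}), T_ξ = Σ_j ε_j ∂_{ξ_j}², T_η = Σ_j ε_j ∂_{η_j}², E_ξ = Σ_j ξ_j ∂_{ξ_j}, E_η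 = Σ_j η_j ∂_{η_j}. -/

import Mathlib

noncomputable section

/-- `ε_i = 1` for `i < p`, `ε_i = -1` for `i ≥ p`: the entries of the flat metric of
signature `(p,q)` on `ℝⁿ`. -/
def eps (p : ℕ) {n : ℕ} (i : Fin n) : ℝ := if (i : ℕ) < p then 1 else -1

/-- The partial derivative `∂_i f`. -/
def pd {n : ℕ} (i : Fin n) (f : (Fin n → ℝ) → ℝ) : (Fin n → ℝ) → ℝ :=
  fun x => fderiv ℝ f x (Pi.single i 1)

/-- The iterated partial derivative `∂^α f` for a multi-index `α`. -/
def pdIter {n : ℕ} (α : Fin n → ℕ) (f : (Fin n → ℝ) → ℝ) : (Fin n → ℝ) → ℝ :=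
  (List.finRange n).foldr (fun i g => (pd i)^[α i] g) f

/-- The flat Laplacian of signature `(p,q)`: `Δf = Σ_i ε_i ∂_i² f`. -/
def lap (p : ℕ) {n : ℕ} (f : (Fin n → ℝ) → ℝ) : (Fin n → ℝ) → ℝ :=
  fun x => ∑ i, eps p i * pd i (pd i f) x

/-- The Lie derivative of a `l`-density along the vector field `X = Σ_i X^i ∂_i`:
`L_X^l f = Σ_i X^i ∂_i f + l·(Σ_i ∂_i X^i)·f`. -/
def lieD {n : ℕ} (X : (Fin n → ℝ) → (Fin n → ℝ)) (l : ℝ)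
    (f : (Fin n → ℝ) → ℝ) : (Fin n → ℝ) → ℝ :=
  fun x => (∑ i, X x i * pd i f x) + l * (∑ i, pd i (fun y => X y i) x) * f x

/-- Translation generator `X_i = ∂_i`. -/
def Xtrans {n : ℕ} (i : Fin n) : (Fin n → ℝ) → (Fin n → ℝ) := fun _ => Pi.single i 1

/-- Rotation generator `X_{ij} = x_i ∂_j − x_j ∂_i` (with `x_i = ε_i x^i`). -/
def Xrot (p : ℕ) {n : ℕ} (i j : Fin n) : (Fin n → ℝ) → (Fin n → ℝ) :=
  fun x => (eps p i * x i) • (Pi.single j 1 : Fin n → ℝ) - (eps p j * x j) • (Pi.single i 1 : Fin n → ℝ)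

/-- The Euler vector field `X_0 = Σ_i x^i ∂_i`. -/
def Xeuler {n : ℕ} : (Fin n → ℝ) → (Fin n → ℝ) := fun x => x

/-- Inversion generator `X̄_i = (Σ_j ε_j (x^j)²) ∂_i − 2 x_i Σ_j x^j ∂_j`. -/
def Xinv (p : ℕ) {n : ℕ} (i : Fin n) : (Fin n → ℝ) → (Fin n → ℝ) :=
  fun x => (∑ j, eps p j * (x j) ^ 2) • (Pi.single i 1 : Fin n → ℝ) - (2 * (eps p i * x i)) • x

/-- The generators of the conformal Lie algebra `o(p+1,q+1)` acting on `ℝⁿ`. -/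
def confGens (p n : ℕ) : Set ((Fin n → ℝ) → (Fin n → ℝ)) :=
  Set.range (Xtrans (n := n)) ∪ {X | ∃ i j, X = Xrot p i j} ∪ {Xeuler} ∪ Set.range (Xinv p)

open MvPolynomial

/-- Index of the variable `x^j` among the `3n` variables `(x, ξ, η)`. -/
def xI {n : ℕ} (j : Fin n) : Fin n ⊕ Fin n ⊕ Fin n := Sum.inl j

/-- Index of the variable `ξ_j` among the `3n` variables `(x, ξ, η)`. -/
def ξI {n : ℕ} (j : Fin n) : Fin n ⊕ Fin n ⊕ Fin n := Sum.inr (Sum.inl j)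

/-- Index of the variable `η_j` among the `3n` variables `(x, ξ, η)`. -/
def ηI {n : ℕ} (j : Fin n) : Fin n ⊕ Fin n ⊕ Fin n := Sum.inr (Sum.inr j)

/-- The operator `M̃_i = L̂_i^δ − ξ_i·T_ξ − η_i·T_η
  + 2((E_ξ + nλ)·ε_i ∂_{ξ_i} + (E_η + nμ)·ε_i ∂_{η_i})` on polynomial symbols in the `3n`
variables `(x, ξ, η)`, where
`L̂_i^δ = (Σ_j ε_j (x^j)²)∂_{x^i} − 2x_i Σ_j x^j ∂_{x^j} − 2nδ·x_i
  − 2Σ_j ((ξ_i x_j − ξ_j x_i)∂_{ξ_j} + (η_i x_j − η_j x_i)∂_{η_j})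
  + 2((Σ_j ξ_j x^j)·ε_i ∂_{ξ_i} + (Σ_j η_j x^j)·ε_i ∂_{η_i})`,
`T_ξ = Σ_j ε_j ∂_{ξ_j}²`, `T_η = Σ_j ε_j ∂_{η_j}²`, `E_ξ = Σ_j ξ_j ∂_{ξ_j}`,
`E_η = Σ_j η_j ∂_{η_j}` (with `x_i = ε_i x^i`). -/
def Mt (p n : ℕ) (i : Fin n) (lam mu del : ℝ)
    (P : MvPolynomial (Fin n ⊕ Fin n ⊕ Fin n) ℝ) :
    MvPolynomial (Fin n ⊕ Fin n ⊕ Fin n) ℝ :=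
  (∑ j, C (eps p j) * X (xI j) ^ 2) * pderiv (xI i) P
  - 2 * (C (eps p i) * X (xI i)) * (∑ j, X (xI j) * pderiv (xI j) P)
  - C (2 * n * del) * (C (eps p i) * X (xI i)) * P
  - 2 * (∑ j, ((X (ξI i) * (C (eps p j) * X (xI j))
        - X (ξI j) * (C (eps p i) * X (xI i))) * pderiv (ξI j) P
      + (X (ηI i) * (C (eps p j) * X (xI j))
        - X (ηI j) * (C (eps p i) * X (xI i))) * pderiv (ηI j) P))
  + 2 * ((∑ j, X (ξI j) * X (xI j)) * (C (eps p i) * pderiv (ξI i) P)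
      + (∑ j, X (ηI j) * X (xI j)) * (C (eps p i) * pderiv (ηI i) P))
  - X (ξI i) * (∑ j, C (eps p j) * pderiv (ξI j) (pderiv (ξI j) P))
  - X (ηI i) * (∑ j, C (eps p j) * pderiv (ηI j) (pderiv (ηI j) P))
  + 2 * (C (eps p i) * ((∑ j, X (ξI j) * pderiv (ξI j) (pderiv (ξI i) P))
        + C ((n : ℝ) * lam) * pderiv (ξI i) P)
      + C (eps p i) * ((∑ j, X (ηI j) * pderiv (ηI j) (pderiv (ηI i) P))
        + C ((n : ℝ) * mu) * pderiv (ηI i) P))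

/-- The bilinear differential operator associated to a polynomial symbol
`P = Σ a_{β,α,γ} x^β ξ^α η^γ`: `Op(P)(f,g) = Σ a_{β,α,γ} x^β (∂^α f)(∂^γ g)`. -/
def Op3 {n : ℕ} (P : MvPolynomial (Fin n ⊕ Fin n ⊕ Fin n) ℝ)
    (f g : (Fin n → ℝ) → ℝ) : (Fin n → ℝ) → ℝ :=
  fun x => ∑ mo ∈ P.support, P.coeff mo * (∏ j, x j ^ mo (xI j)) *
    pdIter (fun i => mo (ξI i)) f x * pdIter (fun i => mo (ηI i)) g x

/-- Smooth functions. -/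
def Sm (n : ℕ) : Submodule ℝ ((Fin n → ℝ) → ℝ) where
  carrier := {f | ContDiff ℝ (⊤ : ℕ∞) f}
  add_mem' := fun {f g} hf hg => by
    simp only [Set.mem_ofPred_eq] at *
    exact ContDiff.add hf hg
  zero_mem' := by
    simp only [Set.mem_ofPred_eq]
    exact contDiff_const (c := (0:ℝ))
  smul_mem' := fun c f hf => by
    simp only [Set.mem_ofPred_eq] at *
    exact ContDiff.const_smul c hf

theorem Sm_smooth {n : ℕ} (f : Sm n) : ContDiff ℝ (⊤ : ℕ∞) f.1 := f.2

theorem Sm_diffAt {n : ℕ} (f : Sm n) (x : Fin n → ℝ) : DifferentiableAt ℝ f.1 x :=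
  ((Sm_smooth f).differentiable (by simp)) x

theorem pd_smooth {n : ℕ} (j : Fin n) {f : (Fin n → ℝ) → ℝ} (hf : ContDiff ℝ (⊤ : ℕ∞) f) :
    ContDiff ℝ (⊤ : ℕ∞) (pd j f) := by
  unfold pd
  have : ContDiff ℝ (⊤ : ℕ∞) (fderiv ℝ f) := hf.fderiv_right (by simp)
  exact this.clm_apply contDiff_const

/-- Partial derivative on smooth functions. -/
def Dm {n : ℕ} (j : Fin n) : Sm n →ₗ[ℝ] Sm n where
  toFun f := ⟨pd j f.1, pd_smooth j f.2⟩
  map_add' f g := by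
    ext x
    simp only [pd, Submodule.coe_add, Pi.add_apply]
    rw [fderiv_add (Sm_diffAt f x) (Sm_diffAt g x)]; rfl
  map_smul' c f := by
    ext x
    simp only [pd, Submodule.coe_smul, Pi.smul_apply, RingHom.id_apply]
    rw [fderiv_const_smul (Sm_diffAt f x)]; rfl

/-- Multiplication by a coordinate on smooth functions. -/
def Xm {n : ℕ} (j : Fin n) : Sm n →ₗ[ℝ] Sm n where
  toFun f := ⟨fun x => x j * f.1 x, (contDiff_apply ℝ ℝ j).mul (Sm_smooth f)⟩
  map_add' f g := by
    ext x
    simp [mul_add]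
  map_smul' c f := by
    ext x
    simp [mul_left_comm]

theorem Xm_comm {n : ℕ} (j k : Fin n) (f : Sm n) : Xm j (Xm k f) = Xm k (Xm j f) := by
  ext x; simp [Xm, mul_left_comm]

theorem pd_coord {n : ℕ} (j k : Fin n) (x : Fin n → ℝ) :
    pd j (fun y => y k) x = if j = k then 1 else 0 := by
  unfold pd
  rw [(hasFDerivAt_apply k x).fderiv]
  simp [Pi.single_apply, eq_comm]

theorem pd_mul {n : ℕ} (j : Fin n) {a b : (Fin n → ℝ) → ℝ} {x : Fin n → ℝ}
    (ha : DifferentiableAt ℝ a x) (hb : DifferentiableAt ℝ b x) :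
    pd j (fun y => a y * b y) x = pd j a x * b x + a x * pd j b x := by
  unfold pd
  rw [fderiv_fun_mul ha hb]
  simp; ring

theorem Dm_Xm {n : ℕ} (j k : Fin n) (f : Sm n) :
    Dm j (Xm k f) = Xm k (Dm j f) + (if j = k then (1:ℝ) else 0) • f := by
  ext x
  have := pd_mul j (a := fun y : Fin n → ℝ => y k) (b := f.1) (x := x)
    (differentiableAt_apply k x) (Sm_diffAt f x)
  rw [pd_coord] at this
  simp only [Dm, Xm, LinearMap.coe_mk, AddHom.coe_mk, Submodule.coe_add, Submodule.coe_smul,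
    Pi.add_apply, Pi.smul_apply, smul_eq_mul, this]
  ring

theorem Dm_comm {n : ℕ} (j k : Fin n) : Dm (n := n) j * Dm k = Dm k * Dm j := by
  ext f x
  simp only [Dm, Module.End.mul_apply, LinearMap.coe_mk, AddHom.coe_mk]
  have hd : DifferentiableAt ℝ (fderiv ℝ f.1) x :=
    (((Sm_smooth f).fderiv_right (m := (⊤ : ℕ∞)) (by simp)).differentiable (by simp)) x
  have key : ∀ a b : Fin n, pd a (pd b f.1) x
      = fderiv ℝ (fderiv ℝ f.1) x (Pi.single a 1) (Pi.single b 1) := by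
    intro a b
    unfold pd
    rw [fderiv_clm_apply hd (differentiableAt_const _)]
    simp
  rw [key, key]
  have hs : IsSymmSndFDerivAt ℝ f.1 x :=
    (Sm_smooth f).contDiffAt.isSymmSndFDerivAt (by
      rw [minSmoothness_of_isRCLikeNormedField]; exact WithTop.coe_le_coe.mpr le_top)
  exact hs _ _

/-- Iterated derivative along a list. -/
def DL {n : ℕ} (α : Fin n → ℕ) (L : List (Fin n)) : Module.End ℝ (Sm n) :=
  L.foldr (fun i T => Dm i ^ α i * T) 1

theorem pow_Dm_coe {n : ℕ} (j : Fin n) (a : ℕ) (f : Sm n) :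
    ((Dm j ^ a) f).1 = (pd j)^[a] f.1 := by
  induction a generalizing f with
  | zero => simp
  | succ a ih =>
    rw [pow_succ, Module.End.mul_apply, ih, Function.iterate_succ_apply]; rfl

theorem DL_coe {n : ℕ} (α : Fin n → ℕ) (L : List (Fin n)) (f : Sm n) :
    (DL α L f).1 = L.foldr (fun i g => (pd i)^[α i] g) f.1 := by
  induction L with
  | nil => simp [DL]
  | cons a L ih =>
    have : DL α (a :: L) = Dm a ^ α a * DL α L := rfl
    rw [this, Module.End.mul_apply, pow_Dm_coe, ih]; rfl

theorem DL_comm {n : ℕ} (α : Fin n → ℕ) (L : List (Fin n)) (j : Fin n) :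
    Commute (Dm j) (DL α L) := by
  induction L with
  | nil => exact Commute.one_right _
  | cons a L ih =>
    have : DL α (a :: L) = Dm a ^ α a * DL α L := rfl
    rw [this]
    exact (Commute.pow_right (Dm_comm j a) _).mul_right ih

theorem DL_single {n : ℕ} (α β : Fin n → ℕ) (j : Fin n)
    (hβ : ∀ i, β i = α i + if i = j then 1 else 0) (L : List (Fin n)) (hL : L.Nodup) :
    DL β L = if j ∈ L then DL α L * Dm j else DL α L := by
  induction L with
  | nil => simp [DL]
  | cons a L ih =>
    have h1 : ∀ γ, DL γ (a :: L) = Dm a ^ γ a * DL γ L := fun _ => rfl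
    rw [List.nodup_cons] at hL
    rw [h1, h1, ih hL.2, hβ]
    by_cases h : a = j
    · subst h
      simp only [hL.1, if_true, if_false, List.mem_cons, true_or, pow_succ]
      rw [mul_assoc, mul_assoc, (DL_comm α L a).eq]
    · have h' : j ≠ a := Ne.symm h
      simp only [h, if_false, add_zero, List.mem_cons, h', false_or]
      split_ifs <;> simp [mul_assoc]

/-- `pdIter` on smooth functions. -/
def DI {n : ℕ} (α : Fin n → ℕ) : Module.End ℝ (Sm n) := DL α (List.finRange n)

theorem DI_coe {n : ℕ} (α : Fin n → ℕ) (f : Sm n) : (DI α f).1 = pdIter α f.1 :=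
  DL_coe α _ f

theorem DI_single {n : ℕ} (α β : Fin n → ℕ) (j : Fin n)
    (hβ : ∀ i, β i = α i + if i = j then 1 else 0) (f : Sm n) :
    DI β f = DI α (Dm j f) := by
  unfold DI
  rw [DL_single α β j hβ _ (List.nodup_finRange n)]
  simp

/-- Evaluation. -/
def ev {n : ℕ} (x : Fin n → ℝ) : Sm n →ₗ[ℝ] ℝ where
  toFun f := f.1 x
  map_add' _ _ := rfl
  map_smul' _ _ := rfl

/-- The operator of a monomial. -/
def Tmo {n : ℕ} (x : Fin n → ℝ) (mo : (Fin n ⊕ Fin n ⊕ Fin n) →₀ ℕ) :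
    Sm n →ₗ[ℝ] Sm n →ₗ[ℝ] ℝ :=
  (∏ j, x j ^ mo (xI j)) • (LinearMap.mul ℝ ℝ).compl₁₂
    (ev x ∘ₗ DI (fun i => mo (ξI i))) (ev x ∘ₗ DI (fun i => mo (ηI i)))

theorem Tmo_apply {n : ℕ} (x : Fin n → ℝ) (mo : (Fin n ⊕ Fin n ⊕ Fin n) →₀ ℕ) (f g : Sm n) :
    Tmo x mo f g = (∏ j, x j ^ mo (xI j)) * ((DI (fun i => mo (ξI i)) f).1 x *
      (DI (fun i => mo (ηI i)) g).1 x) := rfl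

/-- `Op3` as a trilinear map. -/
def Bl {n : ℕ} (x : Fin n → ℝ) :
    MvPolynomial (Fin n ⊕ Fin n ⊕ Fin n) ℝ →ₗ[ℝ] Sm n →ₗ[ℝ] Sm n →ₗ[ℝ] ℝ :=
  (basisMonomials _ ℝ).constr ℝ (Tmo x)

theorem Bl_monomial {n : ℕ} (x : Fin n → ℝ) (mo : (Fin n ⊕ Fin n ⊕ Fin n) →₀ ℕ) (a : ℝ) :
    Bl x (monomial mo a) = a • Tmo x mo := by
  have : (monomial mo a : MvPolynomial (Fin n ⊕ Fin n ⊕ Fin n) ℝ)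
      = a • basisMonomials _ ℝ mo := by
    simp [coe_basisMonomials, smul_monomial]
  rw [this, map_smul, Bl, Module.Basis.constr_basis]

theorem Op3_eq {n : ℕ} (P : MvPolynomial (Fin n ⊕ Fin n ⊕ Fin n) ℝ) (f g : Sm n)
    (x : Fin n → ℝ) : Op3 P f.1 g.1 x = Bl x P f g := by
  conv_rhs => rw [P.as_sum]
  simp only [map_sum, LinearMap.sum_apply, Bl_monomial, LinearMap.smul_apply, Tmo_apply,
    DI_coe, smul_eq_mul, Op3, mul_assoc]

theorem Bl_C_mul {n : ℕ} (x : Fin n → ℝ) (a : ℝ) (P : MvPolynomial (Fin n ⊕ Fin n ⊕ Fin n) ℝ)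
    (f g : Sm n) : Bl x (C a * P) f g = a * Bl x P f g := by
  rw [C_mul', map_smul]; rfl

theorem Bl_X {n : ℕ} (x : Fin n → ℝ) (j : Fin n) (P : MvPolynomial (Fin n ⊕ Fin n ⊕ Fin n) ℝ)
    (f g : Sm n) : Bl x (X (xI j) * P) f g = x j * Bl x P f g := by
  induction P using MvPolynomial.induction_on' with
  | add p q hp hq => simp only [mul_add, map_add, LinearMap.add_apply, hp, hq]
  | monomial mo a =>
    rw [X, monomial_mul, Bl_monomial, Bl_monomial]
    simp only [LinearMap.smul_apply, Tmo_apply, smul_eq_mul, one_mul, Finsupp.add_apply]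
    have h1 : ∏ k, x k ^ ((Finsupp.single (xI j) 1 : (Fin n ⊕ Fin n ⊕ Fin n) →₀ ℕ) (xI k)
        + mo (xI k)) = x j * ∏ k, x k ^ mo (xI k) := by
      simp only [pow_add, Finset.prod_mul_distrib]
      congr 1
      rw [Finset.prod_eq_single j] <;> simp +contextual [xI, Finsupp.single_apply, eq_comm]
    rw [h1]
    simp only [xI, ξI, ηI, Finsupp.single_apply, reduceCtorEq, if_false, zero_add]
    ring

theorem Bl_ξ {n : ℕ} (x : Fin n → ℝ) (j : Fin n) (P : MvPolynomial (Fin n ⊕ Fin n ⊕ Fin n) ℝ)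
    (f g : Sm n) : Bl x (X (ξI j) * P) f g = Bl x P (Dm j f) g := by
  induction P using MvPolynomial.induction_on' with
  | add p q hp hq => simp only [mul_add, map_add, LinearMap.add_apply, hp, hq]
  | monomial mo a =>
    rw [X, monomial_mul, Bl_monomial, Bl_monomial]
    simp only [LinearMap.smul_apply, Tmo_apply, smul_eq_mul, one_mul, Finsupp.add_apply]
    rw [DI_single (fun i => mo (ξI i)) (fun i => (Finsupp.single (ξI j) 1 : (Fin n ⊕ Fin n ⊕ Fin n) →₀ ℕ) (ξI i)
      + mo (ξI i)) j (fun i => by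
      simp [ξI, Finsupp.single_apply, add_comm, eq_comm])]
    simp only [xI, ξI, ηI, Finsupp.single_apply, reduceCtorEq, if_false, zero_add,
      Sum.inr.injEq]

theorem Bl_η {n : ℕ} (x : Fin n → ℝ) (j : Fin n) (P : MvPolynomial (Fin n ⊕ Fin n ⊕ Fin n) ℝ)
    (f g : Sm n) : Bl x (X (ηI j) * P) f g = Bl x P f (Dm j g) := by
  induction P using MvPolynomial.induction_on' with
  | add p q hp hq => simp only [mul_add, map_add, LinearMap.add_apply, hp, hq]
  | monomial mo a =>
    rw [X, monomial_mul, Bl_monomial, Bl_monomial]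
    simp only [LinearMap.smul_apply, Tmo_apply, smul_eq_mul, one_mul, Finsupp.add_apply]
    rw [DI_single (fun i => mo (ηI i)) (fun i => (Finsupp.single (ηI j) 1 : (Fin n ⊕ Fin n ⊕ Fin n) →₀ ℕ) (ηI i)
      + mo (ηI i)) j (fun i => by
      simp [ηI, Finsupp.single_apply, add_comm, eq_comm])]
    simp only [xI, ξI, ηI, Finsupp.single_apply, reduceCtorEq, if_false, zero_add,
      Sum.inr.injEq]

theorem DI_zero {n : ℕ} (f : Sm n) : DI (fun _ => 0) f = f := by
  unfold DI
  induction List.finRange n with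
  | nil => rfl
  | cons a L ih =>
    have h1 : DL (fun _ => 0) (a :: L) = Dm a ^ 0 * DL (fun _ => 0) L := rfl
    rw [h1, pow_zero, one_mul, ih]

theorem Bl_C {n : ℕ} (x : Fin n → ℝ) (a : ℝ) (f g : Sm n) :
    Bl x (C a) f g = a * (f.1 x * g.1 x) := by
  rw [C_apply, Bl_monomial]
  simp [Tmo_apply, DI_zero]

theorem sm_ind {n : ℕ} {motive : MvPolynomial (Fin n ⊕ Fin n ⊕ Fin n) ℝ → Prop}
    (P : MvPolynomial (Fin n ⊕ Fin n ⊕ Fin n) ℝ)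
    (hC : ∀ a, motive (C a)) (hadd : ∀ p q, motive p → motive q → motive (p + q))
    (hx : ∀ j p, motive p → motive (X (xI j) * p))
    (hξ : ∀ j p, motive p → motive (X (ξI j) * p))
    (hη : ∀ j p, motive p → motive (X (ηI j) * p)) : motive P := by
  induction P using MvPolynomial.induction_on with
  | C a => exact hC a
  | add p q hp hq => exact hadd p q hp hq
  | mul_X p v hp =>
    rw [mul_comm]
    rcases v with j | j | j
    · exact hx j p hp
    · exact hξ j p hp
    · exact hη j p hp

theorem Bl_dξ {n : ℕ} (x : Fin n → ℝ) (k : Fin n) (P : MvPolynomial (Fin n ⊕ Fin n ⊕ Fin n) ℝ)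
    (f g : Sm n) : Bl x (pderiv (ξI k) P) f g = Bl x P (Xm k f) g - x k * Bl x P f g := by
  induction P using sm_ind generalizing f g with
  | hC a => simp [Bl_C, Xm]; ring
  | hadd p q hp hq => simp only [map_add, LinearMap.add_apply, hp, hq]; ring
  | hx j p hp =>
    have : pderiv (ξI k) (X (xI j) : MvPolynomial (Fin n ⊕ Fin n ⊕ Fin n) ℝ) = 0 :=
      pderiv_X_of_ne (by simp [xI, ξI])
    rw [pderiv_mul, this, zero_mul, zero_add]
    simp only [Bl_X, hp]; ring
  | hξ j p hp =>
    have : pderiv (ξI k) (X (ξI j) : MvPolynomial (Fin n ⊕ Fin n ⊕ Fin n) ℝ)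
        = C (if j = k then (1:ℝ) else 0) := by
      rw [pderiv_X, Pi.single_apply]; simp only [ξI, Sum.inr.injEq, Sum.inl.injEq]
      split_ifs <;> simp
    rw [pderiv_mul, this]
    simp only [map_add, LinearMap.add_apply, Bl_C_mul, Bl_ξ, hp, Dm_Xm, map_smul,
      LinearMap.smul_apply, smul_eq_mul]; ring
  | hη j p hp =>
    have : pderiv (ξI k) (X (ηI j) : MvPolynomial (Fin n ⊕ Fin n ⊕ Fin n) ℝ) = 0 :=
      pderiv_X_of_ne (by simp [ηI, ξI])
    rw [pderiv_mul, this, zero_mul, zero_add]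
    simp only [Bl_η, hp]

theorem Bl_dη {n : ℕ} (x : Fin n → ℝ) (k : Fin n) (P : MvPolynomial (Fin n ⊕ Fin n ⊕ Fin n) ℝ)
    (f g : Sm n) : Bl x (pderiv (ηI k) P) f g = Bl x P f (Xm k g) - x k * Bl x P f g := by
  induction P using sm_ind generalizing f g with
  | hC a => simp [Bl_C, Xm]; ring
  | hadd p q hp hq => simp only [map_add, LinearMap.add_apply, hp, hq]; ring
  | hx j p hp =>
    have : pderiv (ηI k) (X (xI j) : MvPolynomial (Fin n ⊕ Fin n ⊕ Fin n) ℝ) = 0 :=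
      pderiv_X_of_ne (by simp [xI, ηI])
    rw [pderiv_mul, this, zero_mul, zero_add]
    simp only [Bl_X, hp]; ring
  | hη j p hp =>
    have : pderiv (ηI k) (X (ηI j) : MvPolynomial (Fin n ⊕ Fin n ⊕ Fin n) ℝ)
        = C (if j = k then (1:ℝ) else 0) := by
      rw [pderiv_X, Pi.single_apply]; simp only [ηI, Sum.inr.injEq]
      split_ifs <;> simp
    rw [pderiv_mul, this]
    simp only [map_add, LinearMap.add_apply, Bl_C_mul, Bl_η, hp, Dm_Xm, map_smul,
      smul_eq_mul]; ring
  | hξ j p hp =>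
    have : pderiv (ηI k) (X (ξI j) : MvPolynomial (Fin n ⊕ Fin n ⊕ Fin n) ℝ) = 0 :=
      pderiv_X_of_ne (by simp [ηI, ξI])
    rw [pderiv_mul, this, zero_mul, zero_add]
    simp only [Bl_ξ, hp]

theorem Bl_diff {n : ℕ} (P : MvPolynomial (Fin n ⊕ Fin n ⊕ Fin n) ℝ) (f g : Sm n) :
    Differentiable ℝ (fun x => Bl x P f g) := by
  induction P using sm_ind generalizing f g with
  | hC a =>
    simp only [Bl_C]
    intro x
    exact ((Sm_diffAt f x).mul (Sm_diffAt g x)).const_mul a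
  | hadd p q hp hq => simp only [map_add, LinearMap.add_apply]; exact (hp f g).add (hq f g)
  | hx j p hp => simp only [Bl_X]; exact (differentiable_apply j).mul (hp f g)
  | hξ j p hp => simp only [Bl_ξ]; exact hp _ _
  | hη j p hp => simp only [Bl_η]; exact hp _ _

theorem Bl_pd {n : ℕ} (k : Fin n) (P : MvPolynomial (Fin n ⊕ Fin n ⊕ Fin n) ℝ)
    (f g : Sm n) (x : Fin n → ℝ) : pd k (fun x => Bl x P f g) x
      = Bl x (pderiv (xI k) P) f g + Bl x P (Dm k f) g + Bl x P f (Dm k g) := by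
  induction P using sm_ind generalizing f g with
  | hC a =>
    simp only [Bl_C, pderiv_C, map_zero, LinearMap.zero_apply, zero_add]
    rw [pd_mul k (b := fun y => f.1 y * g.1 y) (differentiableAt_const a)
        ((Sm_diffAt f x).mul (Sm_diffAt g x)),
      pd_mul k (Sm_diffAt f x) (Sm_diffAt g x)]
    simp [pd, Dm]; ring
  | hadd p q hp hq =>
    have h : pd k (fun x => Bl x (p + q) f g) x
        = pd k (fun x => Bl x p f g) x + pd k (fun x => Bl x q f g) x := by
      simp only [map_add, LinearMap.add_apply, pd]
      rw [fderiv_fun_add (Bl_diff p f g x) (Bl_diff q f g x)]; rfl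
    rw [h, hp, hq]
    simp only [map_add, LinearMap.add_apply]; ring
  | hx j p hp =>
    have : pderiv (xI k) (X (xI j) : MvPolynomial (Fin n ⊕ Fin n ⊕ Fin n) ℝ)
        = C (if k = j then (1:ℝ) else 0) := by
      rw [pderiv_X, Pi.single_apply]; simp only [xI, Sum.inl.injEq, eq_comm]
      split_ifs <;> simp
    rw [pderiv_mul, this]
    simp only [Bl_X, map_add, LinearMap.add_apply, Bl_C_mul]
    rw [pd_mul k (differentiableAt_apply j x) (Bl_diff p f g x), hp, pd_coord]
    ring
  | hξ j p hp =>
    have : pderiv (xI k) (X (ξI j) : MvPolynomial (Fin n ⊕ Fin n ⊕ Fin n) ℝ) = 0 :=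
      pderiv_X_of_ne (by simp [xI, ξI])
    rw [pderiv_mul, this, zero_mul, zero_add]
    have hc : Dm j (Dm k f) = Dm k (Dm j f) := LinearMap.congr_fun (Dm_comm j k) f
    simp only [Bl_ξ, hp, hc]
  | hη j p hp =>
    have : pderiv (xI k) (X (ηI j) : MvPolynomial (Fin n ⊕ Fin n ⊕ Fin n) ℝ) = 0 :=
      pderiv_X_of_ne (by simp [xI, ηI])
    rw [pderiv_mul, this, zero_mul, zero_add]
    have hc : Dm j (Dm k g) = Dm k (Dm j g) := LinearMap.congr_fun (Dm_comm j k) g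
    simp only [Bl_η, hp, hc]

theorem Xinv_sum {n : ℕ} (p : ℕ) (i : Fin n) (x v : Fin n → ℝ) :
    ∑ k, Xinv p i x k * v k
      = ∑ j, eps p j * x j ^ 2 * v i - ∑ k, 2 * (eps p i * x i) * x k * v k := by
  simp only [Xinv, Pi.sub_apply, Pi.smul_apply, smul_eq_mul, sub_mul, Finset.sum_sub_distrib]
  congr 1
  rw [Finset.sum_eq_single i]
  · simp [Finset.sum_mul]
  · intro b _ hb; simp [hb]
  · simp

theorem Xinv_div {n : ℕ} (p : ℕ) (i : Fin n) (x : Fin n → ℝ) :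
    ∑ k, pd k (fun y => Xinv p i y k) x = -(2 * n * (eps p i * x i)) := by
  have hq : DifferentiableAt ℝ (fun y : Fin n → ℝ => ∑ j, eps p j * y j ^ 2) x := by fun_prop
  have hc : ∀ k : Fin n, HasFDerivAt (fun y : Fin n → ℝ => y k)
      (ContinuousLinearMap.proj (R := ℝ) (φ := fun _ : Fin n => ℝ) k) x :=
    fun k => hasFDerivAt_apply k x
  have h : ∀ k, pd k (fun y => Xinv p i y k) x
      = (if k = i then 2 * (eps p i * x i) else 0)
        - (if k = i then 2 * (eps p i * x i) else 0) - 2 * (eps p i * x i) := by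
    intro k
    unfold pd
    simp only [Xinv, Pi.sub_apply, Pi.smul_apply, smul_eq_mul]
    have h1 := ((HasFDerivAt.fun_sum (u := Finset.univ)
      (fun j _ => ((hc j).pow 2).const_mul (eps p j))).mul_const
        ((Pi.single i 1 : Fin n → ℝ) k)).sub
      ((((hc i).const_mul (eps p i)).const_mul 2).mul (hc k))
    erw [HasFDerivAt.fderiv h1]
    by_cases hk : k = i
    · subst hk
      simp [Pi.single_apply]
      ring
    · simp [Pi.single_apply, hk, Ne.symm hk]
  rw [Finset.sum_congr rfl (fun k _ => h k)]
  simp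
  ring

/-- Lie derivative on smooth functions. -/
def Lm {n : ℕ} (p : ℕ) (i : Fin n) (l : ℝ) (f : Sm n) : Sm n :=
  ∑ j, eps p j • Xm j (Xm j (Dm i f)) - ∑ k, (2 * eps p i) • Xm i (Xm k (Dm k f))
    - (2 * n * l * eps p i) • Xm i f

theorem Lm_coe {n : ℕ} (p : ℕ) (i : Fin n) (l : ℝ) (f : Sm n) :
    lieD (Xinv p i) l f.1 = (Lm p i l f).1 := by
  ext x
  unfold lieD Lm
  rw [Xinv_sum p i x (fun k => pd k f.1 x), Xinv_div]
  simp only [Submodule.coe_sub, Submodule.coe_sum, Submodule.coe_smul, Pi.sub_apply,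
    Finset.sum_apply, Pi.smul_apply, smul_eq_mul, Xm, Dm, LinearMap.coe_mk, AddHom.coe_mk]
  have e1 : ∀ j, eps p j * x j ^ 2 * pd i f.1 x = eps p j * (x j * (x j * pd i f.1 x)) := by
    intro j; ring
  have e2 : ∀ k, 2 * (eps p i * x i) * x k * pd k f.1 x
      = 2 * eps p i * (x i * (x k * pd k f.1 x)) := by
    intro j; ring
  simp only [e1, e2]
  ring

/-- (Bilinear analogue of Proposition 3.1.) The action of the inversion generator `X̄_i` on
the bilinear differential operator `Op(P) : F_λ ⊗ F_μ → F_ν` is given, at the level of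
symbols, by the operator `M̃_i`, where `δ = ν − λ − μ`. -/
theorem inversion_action_on_bilinear_symbols (p q n : ℕ) (hn : n = p + q) (hn1 : 1 ≤ n)
    (l m nu d : ℝ) (hd : d = nu - l - m) (i : Fin n)
    (P : MvPolynomial (Fin n ⊕ Fin n ⊕ Fin n) ℝ)
    (f g : (Fin n → ℝ) → ℝ) (hf : ContDiff ℝ (⊤ : ℕ∞) f) (hg : ContDiff ℝ (⊤ : ℕ∞) g) (x : Fin n → ℝ) :
    lieD (Xinv p i) nu (Op3 P f g) x - Op3 P (lieD (Xinv p i) l f) g x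
        - Op3 P f (lieD (Xinv p i) m g) x
      = Op3 (Mt p n i l m d P) f g x := by
  obtain ⟨F, rfl⟩ : ∃ F : Sm n, F.1 = f := ⟨⟨f, hf⟩, rfl⟩
  obtain ⟨G, rfl⟩ : ∃ G : Sm n, G.1 = g := ⟨⟨g, hg⟩, rfl⟩
  rw [Lm_coe, Lm_coe, Op3_eq, Op3_eq, Op3_eq]
  have hop : Op3 P F.1 G.1 = fun x => Bl x P F G := funext fun x => Op3_eq P F G x
  rw [hop]
  unfold lieD
  rw [Xinv_sum p i x (fun k => pd k (fun x => Bl x P F G) x), Xinv_div]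
  simp only [Bl_pd]
  have h2 : (2 : MvPolynomial (Fin n ⊕ Fin n ⊕ Fin n) ℝ) = C 2 :=
    (map_ofNat C 2).symm
  unfold Mt Lm
  rw [h2]
  simp only [Finset.sum_mul, Finset.mul_sum, mul_add, add_mul, sub_mul, mul_sub, mul_assoc, pow_two,
    map_sum, map_add, map_sub, LinearMap.sum_apply, LinearMap.add_apply, LinearMap.sub_apply,
    Bl_C_mul, Bl_X, Bl_ξ, Bl_η, Bl_dξ, Bl_dη, map_smul, LinearMap.smul_apply, smul_eq_mul,
    Finset.sum_add_distrib, Finset.sum_sub_distrib, hd]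
  ring_nf
  simp only [← Finset.sum_mul]
  ring_nf
  have pull : ∀ c : ℝ, ∑ j, c * eps p j * x j ^ 2 = c * ∑ j, eps p j * x j ^ 2 := by
    intro c
    rw [Finset.mul_sum]
    exact Finset.sum_congr rfl fun j _ => mul_assoc _ _ _
  rw [pull, pull, pull]
  ring

end
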